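/- arXiv:2309.13870 — 3 statements merged into one kernel-verified Lean document; each statement's English description precedes it below -/
import Mathlib

section
/- (Mirror rules) Let m,n ≥ 1, let σ ⊆ m^n be a partition, let t ∈ I_σ, and set t̄ := v⁻ − t. Then t̄ is an outer corner of σ̄ (so σ̄∪t̄ is a partition), and: (i) for every s ∈ O_σ with s₁ ≤ m−1 and s₂ ≤ n−1, writing s̄ := v⁻ − s, we have uh_σ(s∧t) = uh_{σ̄}(s̄∧t̄) and lh_σ(s∧t) = lh_{σ̄}(s̄∧t̄); (ii) for every w ∈ I_σ with w ≠ t, writing w̄ := v⁻ − w, we have uh_{σ∖t}(w∧t) = uh_{σ̄∪t̄}(w̄∧t̄) and lh_{σ∖t}(w∧t) = lh_{σ̄∪t̄}(w̄∧t̄). -/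
/-!
Common setup: boxes, Young diagrams as finite lower sets of boxes (French notation),
arms, legs, hooks, the field `ℚ(α)`, rational functions in `u` over `ℚ(α)`,
the functions `T_Γ`, corners, star products, rectangles and complements.
-/

open scoped BigOperators

attribute [local instance] Classical.propDecidable

namespace JackLR

/-- A box `(x, y)`: `x` is the column index, `y` the row index (French notation). -/
abbrev Box := ℕ × ℕ

/-- The field `ℚ(α)`. -/
abbrev K := RatFunc ℚ

/-- Rational functions in a variable `u` with coefficients in `ℚ(α)`. -/
abbrev F := RatFunc K

/-- The indeterminate `α`. -/
noncomputable def alpha : K := RatFunc.X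

/-- `[c] := α·x − y` for `c = (x, y) ∈ ℤ²`. -/
noncomputable def brk (c : ℤ × ℤ) : K := alpha * (c.1 : K) - (c.2 : K)

/-- The embedding of a box into `ℤ²`. -/
def zb (b : Box) : ℤ × ℤ := ((b.1 : ℤ), (b.2 : ℤ))

/-- `[b]` for a box `b`. -/
noncomputable def brkN (b : Box) : K := brk (zb b)

/-- `S` is the set of boxes of a Young diagram (equivalently, of a partition). -/
def IsYoung (S : Finset Box) : Prop := IsLowerSet (↑S : Set Box)

/-- The arm of `s`: number of boxes of `S` strictly to the right of `s` in its row. -/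
def arm (S : Finset Box) (s : Box) : ℕ := (S.filter fun b => b.2 = s.2 ∧ s.1 < b.1).card

/-- The leg of `s`: number of boxes of `S` strictly above `s` in its column. -/
def leg (S : Finset Box) (s : Box) : ℕ := (S.filter fun b => b.1 = s.1 ∧ s.2 < b.2).card

/-- Upper hook vector `h⁺_S(s) = (arm+1, −leg)`. -/
def hup (S : Finset Box) (s : Box) : ℤ × ℤ := ((arm S s : ℤ) + 1, -(leg S s : ℤ))

/-- Lower hook vector `h⁻_S(s) = (arm, −leg−1)`. -/
def hlo (S : Finset Box) (s : Box) : ℤ × ℤ := ((arm S s : ℤ), -((leg S s : ℤ) + 1))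

/-- Upper hook value `uh_S(s) = α(arm+1) + leg`. -/
noncomputable def uh (S : Finset Box) (s : Box) : K := brk (hup S s)

/-- Lower hook value `lh_S(s) = α·arm + leg + 1`. -/
noncomputable def lh (S : Finset Box) (s : Box) : K := brk (hlo S s)

/-- The variable `u`. -/
noncomputable def uu : F := RatFunc.X

/-- `T_□(w) = (w−[0,0])(w−[1,1]) / ((w−[1,0])(w−[0,1]))`. -/
noncomputable def Tbox (w : F) : F :=
  ((w - RatFunc.C (brk (0, 0))) * (w - RatFunc.C (brk (1, 1)))) /
    ((w - RatFunc.C (brk (1, 0))) * (w - RatFunc.C (brk (0, 1))))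

/-- `T_Γ` with the variable `u` replaced by `w`. -/
noncomputable def TMat (Γ : Multiset Box) (w : F) : F :=
  (Γ.map fun b => Tbox (w - RatFunc.C (brkN b))).prod

/-- `T_Γ(u) = ∏_{b ∈ Γ} T_□(u − [b])` for a finite multiset `Γ` of boxes. -/
noncomputable def TM (Γ : Multiset Box) : F := TMat Γ uu

/-- `T_S(u)` for a finite set `S` of boxes. -/
noncomputable def TS (S : Finset Box) : F := TM S.val

/-- The star product `μ * ν` as the multiset `{s + t : s ∈ μ, t ∈ ν}` with multiplicity. -/
def star (μ ν : Finset Box) : Multiset Box :=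
  μ.val.bind fun s => ν.val.map fun t => (s.1 + t.1, s.2 + t.2)

/-- The rectangular partition `m^n` (n rows of length m). -/
def rect (m n : ℕ) : Finset Box := Finset.range m ×ˢ Finset.range n

/-- `v⁻ = (m−1, n−1)`. -/
def vminus (m n : ℕ) : Box := (m - 1, n - 1)

/-- `b̄ := v⁻ − b`. -/
def conjBox (m n : ℕ) (b : Box) : Box := (m - 1 - b.1, n - 1 - b.2)

/-- The complement partition of `μ ⊆ m^n` inside `m^n`, with boxes `{v⁻ − b : b ∈ m^n, b ∉ μ}`. -/
def complIn (m n : ℕ) (μ : Finset Box) : Finset Box := (rect m n \ μ).image (conjBox m n)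

/-- `b̂ := (m−1−b₁, b₂)`. -/
def hflip (m : ℕ) (b : Box) : Box := (m - 1 - b.1, b.2)

/-- `b̌ := (b₁, n−1−b₂)`. -/
def vflip (n : ℕ) (b : Box) : Box := (b.1, n - 1 - b.2)

/-- Inner corners `I_S`: removable boxes. -/
def Inner (S : Finset Box) : Finset Box :=
  S.filter fun s => (s.1 + 1, s.2) ∉ S ∧ (s.1, s.2 + 1) ∉ S

/-- `t` can be added to `S` to give again a Young diagram. -/
def addable (S : Finset Box) (t : Box) : Prop :=
  t ∉ S ∧ (t.1 = 0 ∨ (t.1 - 1, t.2) ∈ S) ∧ (t.2 = 0 ∨ (t.1, t.2 - 1) ∈ S)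

/-- Outer corners `O_S`: addable boxes (these all satisfy the bounds used below). -/
noncomputable def Outer (S : Finset Box) : Finset Box :=
  ((Finset.range (S.sup Prod.fst + 2)) ×ˢ (Finset.range (S.sup Prod.snd + 2))).filter
    fun t => addable S t

/-- `I⁺_S = {s + (1,1) : s ∈ I_S}`. -/
noncomputable def Iplus (S : Finset Box) : Finset Box :=
  (Inner S).image fun s => (s.1 + 1, s.2 + 1)

/-- `R^s_S` : boxes of `S` in the same row as `s`. -/
def rowOf (S : Finset Box) (s : Box) : Finset Box := S.filter fun b => b.2 = s.2

/-- `C^s_S` : boxes of `S` in the same column as `s`. -/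
def colOf (S : Finset Box) (s : Box) : Finset Box := S.filter fun b => b.1 = s.1

/-- `a ∧ b := (min a₁ b₁, min a₂ b₂)`. -/
def meet (a b : Box) : Box := (min a.1 b.1, min a.2 b.2)

/-- Pole order of `f` at `u = c`: multiplicity of `(u − c)` in the denominator minus its
multiplicity in the numerator, `f` being written in lowest terms. -/
noncomputable def polOrder (f : F) (c : K) : ℤ :=
  (f.denom.rootMultiplicity c : ℤ) - (f.num.rootMultiplicity c : ℤ)

/-- `ϖ_S = ∏_{b ∈ S, b ≠ (0,0)} [b]`. -/
noncomputable def varpi (S : Finset Box) : K := ∏ b ∈ S.erase (0, 0), brkN b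

lemma arm_eq_of_mem_iff {S : Finset Box} {s : Box} {k : ℕ}
    (h : ∀ x, s.1 < x → ((x, s.2) ∈ S ↔ x ≤ s.1 + k)) : arm S s = k := by
  have key : (S.filter fun b => b.2 = s.2 ∧ s.1 < b.1) =
      Finset.Ioc s.1 (s.1 + k) ×ˢ {s.2} := by
    ext ⟨x, y⟩
    simp only [Finset.mem_filter, Finset.mem_product, Finset.mem_Ioc, Finset.mem_singleton]
    grind
  rw [arm, key]
  simp

lemma leg_eq_of_mem_iff {S : Finset Box} {s : Box} {k : ℕ}
    (h : ∀ y, s.2 < y → ((s.1, y) ∈ S ↔ y ≤ s.2 + k)) : leg S s = k := by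
  have key : (S.filter fun b => b.1 = s.1 ∧ s.2 < b.2) =
      {s.1} ×ˢ Finset.Ioc s.2 (s.2 + k) := by
    ext ⟨x, y⟩
    simp only [Finset.mem_filter, Finset.mem_product, Finset.mem_Ioc, Finset.mem_singleton]
    grind
  rw [leg, key]
  simp

lemma hooks_eq_of_arm_leg {S S' : Finset Box} {s s' : Box} {k l : ℕ}
    (ha : arm S s = k) (ha' : arm S' s' = k) (hl : leg S s = l) (hl' : leg S' s' = l) :
    uh S s = uh S' s' ∧ lh S s = lh S' s' := by
  simp [uh, lh, hup, hlo, ha, ha', hl, hl']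

lemma mem_complIn {m n : ℕ} {σ : Finset Box} {x y : ℕ} :
    (x, y) ∈ complIn m n σ ↔ x < m ∧ y < n ∧ (m - 1 - x, n - 1 - y) ∉ σ := by
  simp only [complIn, rect, conjBox, Finset.mem_image, Finset.mem_sdiff, Finset.mem_product,
    Finset.mem_range, Prod.exists, Prod.mk.injEq]
  constructor
  · rintro ⟨a, b, ⟨⟨ha, hb⟩, h⟩, rfl, rfl⟩
    refine ⟨by omega, by omega, ?_⟩
    rwa [show m - 1 - (m - 1 - a) = a by omega, show n - 1 - (n - 1 - b) = b by omega]
  · rintro ⟨hx, hy, h⟩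
    exact ⟨_, _, ⟨⟨by omega, by omega⟩, h⟩, by omega, by omega⟩

lemma IsYoung.mem_of_le {S : Finset Box} (hS : IsYoung S) {a b c d : ℕ}
    (h : (c, d) ∈ S) (hac : a ≤ c) (hbd : b ≤ d) : (a, b) ∈ S :=
  hS (show (a, b) ≤ (c, d) from ⟨hac, hbd⟩) h

lemma IsYoung.mem_row_inner_iff {S : Finset Box} (hS : IsYoung S) {a b : ℕ}
    (h : (a, b) ∈ Inner S) (x : ℕ) : (x, b) ∈ S ↔ x ≤ a := by
  obtain ⟨h1, h2, -⟩ := Finset.mem_filter.1 h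
  refine ⟨fun hx => ?_, fun hx => hS.mem_of_le h1 hx le_rfl⟩
  by_contra! hlt
  exact h2 (hS.mem_of_le hx hlt le_rfl)

lemma IsYoung.mem_col_inner_iff {S : Finset Box} (hS : IsYoung S) {a b : ℕ}
    (h : (a, b) ∈ Inner S) (y : ℕ) : (a, y) ∈ S ↔ y ≤ b := by
  obtain ⟨h1, -, h2⟩ := Finset.mem_filter.1 h
  refine ⟨fun hy => ?_, fun hy => hS.mem_of_le h1 le_rfl hy⟩
  by_contra! hlt
  exact h2 (hS.mem_of_le hy le_rfl hlt)

lemma IsYoung.mem_row_addable_iff {S : Finset Box} (hS : IsYoung S) {a b : ℕ}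
    (h : addable S (a, b)) (x : ℕ) : (x, b) ∈ S ↔ x < a := by
  obtain ⟨h1, h2, -⟩ := h
  refine ⟨fun hx => ?_, fun hx => ?_⟩
  · by_contra! hle
    exact h1 (hS.mem_of_le hx hle le_rfl)
  · rcases h2 with h2 | h2
    · exact absurd hx (by simp_all)
    · exact hS.mem_of_le h2 (by dsimp only; omega) le_rfl

lemma IsYoung.mem_col_addable_iff {S : Finset Box} (hS : IsYoung S) {a b : ℕ}
    (h : addable S (a, b)) (y : ℕ) : (a, y) ∈ S ↔ y < b := by
  obtain ⟨h1, -, h2⟩ := h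
  refine ⟨fun hy => ?_, fun hy => ?_⟩
  · by_contra! hle
    exact h1 (hS.mem_of_le hy le_rfl hle)
  · rcases h2 with h2 | h2
    · exact absurd hy (by simp_all)
    · exact hS.mem_of_le h2 le_rfl (by dsimp only; omega)

/-- **Mirror rules.** Hooks at meets of corners of `σ ⊆ m^n` equal hooks at
meets of the complementary corners of `σ̄`. -/
theorem stmt6 (m n : ℕ) (hm : 1 ≤ m) (hn : 1 ≤ n) (σ : Finset Box) (hσ : IsYoung σ)
    (hsub : σ ⊆ rect m n) (t : Box) (ht : t ∈ Inner σ) :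
    addable (complIn m n σ) (conjBox m n t) ∧
    (∀ s ∈ Outer σ, s.1 ≤ m - 1 → s.2 ≤ n - 1 →
      uh σ (meet s t) = uh (complIn m n σ) (meet (conjBox m n s) (conjBox m n t)) ∧
      lh σ (meet s t) = lh (complIn m n σ) (meet (conjBox m n s) (conjBox m n t))) ∧
    (∀ w ∈ Inner σ, w ≠ t →
      uh (σ.erase t) (meet w t) =
        uh (insert (conjBox m n t) (complIn m n σ)) (meet (conjBox m n w) (conjBox m n t)) ∧
      lh (σ.erase t) (meet w t) =
        lh (insert (conjBox m n t) (complIn m n σ)) (meet (conjBox m n w) (conjBox m n t))) := by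
  obtain ⟨a, b⟩ := t
  have htσ : (a, b) ∈ σ := (Finset.mem_filter.1 ht).1
  have hrow := hσ.mem_row_inner_iff ht
  have hcol := hσ.mem_col_inner_iff ht
  have hrect : ∀ {x y : ℕ}, (x, y) ∈ σ → x < m ∧ y < n := fun h => by
    simpa [rect] using hsub h
  obtain ⟨ham, hbn⟩ := hrect htσ
  have conj_a : m - 1 - (m - 1 - a) = a := by omega
  have conj_b : n - 1 - (n - 1 - b) = b := by omega
  refine ⟨⟨?_, ?_, ?_⟩, ?_, ?_⟩
  · simp only [conjBox, mem_complIn, conj_a, conj_b]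
    tauto
  · simp only [conjBox, mem_complIn, conj_b, hrow]
    omega
  · simp only [conjBox, mem_complIn, conj_a, hcol]
    omega
  · rintro ⟨c, d⟩ hs hcm hdn
    have hadd : addable σ (c, d) := (Finset.mem_filter.1 hs).2
    have hrow' := hσ.mem_row_addable_iff hadd
    have hcol' := hσ.mem_col_addable_iff hadd
    dsimp only at hcm hdn
    have conj_c : m - 1 - (m - 1 - c) = c := by omega
    have conj_d : n - 1 - (n - 1 - d) = d := by omega
    rcases lt_or_ge a c with hac | hca
    · have hdb : d ≤ b := (hcol d).1 ((hrow' a).2 hac)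
      have e₁ : meet (c, d) (a, b) = (a, d) := by
        simp only [meet, Prod.mk.injEq]; omega
      have e₂ : meet (conjBox m n (c, d)) (conjBox m n (a, b)) = (m - 1 - c, n - 1 - b) := by
        simp only [meet, conjBox, Prod.mk.injEq]; omega
      rw [e₁, e₂]
      apply hooks_eq_of_arm_leg (k := c - 1 - a) (l := b - d)
      · apply arm_eq_of_mem_iff
        intro x hx
        rw [hrow']; dsimp only at hx ⊢; omega
      · apply arm_eq_of_mem_iff
        intro x hx
        rw [mem_complIn, conj_b, hrow]; dsimp only at hx ⊢; omega
      · apply leg_eq_of_mem_iff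
        intro y hy
        rw [hcol]; dsimp only at hy ⊢; omega
      · apply leg_eq_of_mem_iff
        intro y hy
        rw [mem_complIn, conj_c, hcol']; dsimp only at hy ⊢; omega
    · have hbd : b < d := by
        by_contra! hdb
        exact hadd.1 (hσ.mem_of_le htσ hca hdb)
      have e₁ : meet (c, d) (a, b) = (c, b) := by
        simp only [meet, Prod.mk.injEq]; omega
      have e₂ : meet (conjBox m n (c, d)) (conjBox m n (a, b)) = (m - 1 - a, n - 1 - d) := by
        simp only [meet, conjBox, Prod.mk.injEq]; omega
      rw [e₁, e₂]
      apply hooks_eq_of_arm_leg (k := a - c) (l := d - 1 - b)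
      · apply arm_eq_of_mem_iff
        intro x hx
        rw [hrow]; dsimp only at hx ⊢; omega
      · apply arm_eq_of_mem_iff
        intro x hx
        rw [mem_complIn, conj_d, hrow']; dsimp only at hx ⊢; omega
      · apply leg_eq_of_mem_iff
        intro y hy
        rw [hcol']; dsimp only at hy ⊢; omega
      · apply leg_eq_of_mem_iff
        intro y hy
        rw [mem_complIn, conj_a, hcol]; dsimp only at hy ⊢; omega
  · rintro ⟨c, d⟩ hw hne
    have hwσ : (c, d) ∈ σ := (Finset.mem_filter.1 hw).1
    have hrow' := hσ.mem_row_inner_iff hw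
    have hcol' := hσ.mem_col_inner_iff hw
    obtain ⟨hcm, hdn⟩ := hrect hwσ
    have conj_c : m - 1 - (m - 1 - c) = c := by omega
    have conj_d : n - 1 - (n - 1 - d) = d := by omega
    rcases lt_trichotomy a c with hac | rfl | hca
    · have hdb : d < b := by
        by_contra! hle
        exact absurd ((hrow c).1 (hσ.mem_of_le hwσ le_rfl hle)) (by omega)
      have e₁ : meet (c, d) (a, b) = (a, d) := by
        simp only [meet, Prod.mk.injEq]; omega
      have e₂ : meet (conjBox m n (c, d)) (conjBox m n (a, b)) = (m - 1 - c, n - 1 - b) := by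
        simp only [meet, conjBox, Prod.mk.injEq]; omega
      rw [e₁, e₂]
      apply hooks_eq_of_arm_leg (k := c - a) (l := b - 1 - d)
      · apply arm_eq_of_mem_iff
        intro x hx
        rw [Finset.mem_erase, hrow', Ne, Prod.mk.injEq]; dsimp only at hx ⊢; omega
      · apply arm_eq_of_mem_iff
        intro x hx
        rw [Finset.mem_insert, mem_complIn, conj_b, hrow, conjBox, Prod.mk.injEq]
        dsimp only at hx ⊢; omega
      · apply leg_eq_of_mem_iff
        intro y hy
        rw [Finset.mem_erase, hcol, Ne, Prod.mk.injEq]; dsimp only at hy ⊢; omega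
      · apply leg_eq_of_mem_iff
        intro y hy
        rw [Finset.mem_insert, mem_complIn, conj_c, hcol', conjBox, Prod.mk.injEq]
        dsimp only at hy ⊢; omega
    · have h₁ := (hcol d).1 hwσ
      have h₂ := (hcol' b).1 htσ
      exact absurd (by rw [le_antisymm h₁ h₂]) hne
    · have hbd : b < d := by
        by_contra! hle
        exact absurd ((hrow' a).1 (hσ.mem_of_le htσ le_rfl hle)) (by omega)
      have e₁ : meet (c, d) (a, b) = (c, b) := by
        simp only [meet, Prod.mk.injEq]; omega
      have e₂ : meet (conjBox m n (c, d)) (conjBox m n (a, b)) = (m - 1 - a, n - 1 - d) := by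
        simp only [meet, conjBox, Prod.mk.injEq]; omega
      rw [e₁, e₂]
      apply hooks_eq_of_arm_leg (k := a - 1 - c) (l := d - b)
      · apply arm_eq_of_mem_iff
        intro x hx
        rw [Finset.mem_erase, hrow, Ne, Prod.mk.injEq]; dsimp only at hx ⊢; omega
      · apply arm_eq_of_mem_iff
        intro x hx
        rw [Finset.mem_insert, mem_complIn, conj_d, hrow', conjBox, Prod.mk.injEq]
        dsimp only at hx ⊢; omega
      · apply leg_eq_of_mem_iff
        intro y hy
        rw [Finset.mem_erase, hcol', Ne, Prod.mk.injEq]; dsimp only at hy ⊢; omega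
      · apply leg_eq_of_mem_iff
        intro y hy
        rw [Finset.mem_insert, mem_complIn, conj_a, hcol, conjBox, Prod.mk.injEq]
        dsimp only at hy ⊢; omega

end JackLR
end

section
/- Let μ, ν be partitions and s ∈ ℤ². Then the pole order of T_{μ*ν}(u) at u = [s] equals |{b ∈ ν : s−b ∈ O_μ}| − |{b ∈ ν : s−b ∈ I⁺_μ ∪ {(0,0)}}|. -/
/-!
Common setup: boxes, Young diagrams as finite lower sets of boxes (French notation),
arms, legs, hooks, the field `ℚ(α)`, rational functions in `u` over `ℚ(α)`,
the functions `T_Γ`, corners, star products, rectangles and complements.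
-/

open scoped BigOperators

attribute [local instance] Classical.propDecidable

namespace JackLR

theorem polOrder_eq_of_mul_eq {f : F} (hf : f ≠ 0) {p q : Polynomial K} (hp : p ≠ 0) (hq : q ≠ 0)
    (h : f.num * q = p * f.denom) (c : K) :
    polOrder f c = (q.rootMultiplicity c : ℤ) - (p.rootMultiplicity c : ℤ) := by
  have hn := RatFunc.num_ne_zero hf
  have hd := RatFunc.denom_ne_zero f
  have h' := congrArg (Polynomial.rootMultiplicity c) h
  rw [Polynomial.rootMultiplicity_mul (mul_ne_zero hn hq),
    Polynomial.rootMultiplicity_mul (mul_ne_zero hp hd)] at h'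
  unfold polOrder
  omega

theorem polOrder_mul {f g : F} (hf : f ≠ 0) (hg : g ≠ 0) (c : K) :
    polOrder (f * g) c = polOrder f c + polOrder g c := by
  have hfn := RatFunc.num_ne_zero hf
  have hgn := RatFunc.num_ne_zero hg
  have hd := mul_ne_zero (RatFunc.denom_ne_zero f) (RatFunc.denom_ne_zero g)
  rw [polOrder_eq_of_mul_eq (mul_ne_zero hf hg) (mul_ne_zero hfn hgn) hd
      (RatFunc.num_denom_mul f g),
    Polynomial.rootMultiplicity_mul hd, Polynomial.rootMultiplicity_mul (mul_ne_zero hfn hgn)]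
  unfold polOrder
  push_cast
  ring

theorem polOrder_one (c : K) : polOrder 1 c = 0 := by
  simp [polOrder]

theorem polOrder_div {f g : F} (hf : f ≠ 0) (hg : g ≠ 0) (c : K) :
    polOrder (f / g) c = polOrder f c - polOrder g c := by
  have h := polOrder_mul (div_ne_zero hf hg) hg c
  rw [div_mul_cancel₀ f hg] at h
  omega

theorem polOrder_multiset_prod (M : Multiset F) (hM : ∀ f ∈ M, f ≠ 0) (c : K) :
    polOrder M.prod c = (M.map fun f => polOrder f c).sum := by
  induction M using Multiset.induction_on with
  | empty => simp [polOrder_one]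
  | cons f M ih =>
    have hM' : ∀ g ∈ M, g ≠ 0 := fun g hg => hM g (Multiset.mem_cons_of_mem hg)
    rw [Multiset.prod_cons, Multiset.map_cons, Multiset.sum_cons,
      polOrder_mul (hM f (Multiset.mem_cons_self f M))
        (Multiset.prod_ne_zero fun h => hM' 0 h rfl), ih hM']

theorem uu_sub_C_eq (a : K) :
    uu - RatFunc.C a = algebraMap (Polynomial K) F (Polynomial.X - Polynomial.C a) := by
  simp [uu]

theorem uu_sub_C_ne_zero (a : K) : uu - RatFunc.C a ≠ 0 := by
  rw [uu_sub_C_eq]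
  exact RatFunc.algebraMap_ne_zero (Polynomial.X_sub_C_ne_zero a)

theorem polOrder_uu_sub_C (a c : K) :
    polOrder (uu - RatFunc.C a) c = -(if c = a then 1 else 0) := by
  rw [uu_sub_C_eq, polOrder, RatFunc.num_algebraMap, RatFunc.denom_algebraMap,
    Polynomial.rootMultiplicity_X_sub_C,
    show Polynomial.rootMultiplicity c (1 : Polynomial K) = 0 from
      Polynomial.rootMultiplicity_C 1 c]
  simp

theorem brk_add (a b : ℤ × ℤ) : brk (a + b) = brk a + brk b := by
  simp only [brk, Prod.fst_add, Prod.snd_add]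
  push_cast
  ring

theorem brk_eq_zero_iff (c : ℤ × ℤ) : brk c = 0 ↔ c = 0 := by
  refine ⟨fun h => ?_, fun h => by simp [h, brk]⟩
  have hp : algebraMap (Polynomial ℚ) K
      (Polynomial.X * Polynomial.C (c.1 : ℚ) - Polynomial.C (c.2 : ℚ)) = 0 := by
    rw [← h]
    simp [brk, alpha]
  have hp := (map_eq_zero_iff _ (RatFunc.algebraMap_injective ℚ)).1 hp
  have h0 := congrArg (fun p : Polynomial ℚ => p.coeff 0) hp
  have h1 := congrArg (fun p : Polynomial ℚ => p.coeff 1) hp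
  simp only [Polynomial.coeff_sub, Polynomial.coeff_mul_C, Polynomial.coeff_X_zero,
    Polynomial.coeff_X_one, Polynomial.coeff_C, Polynomial.coeff_zero, one_ne_zero, if_true,
    if_false, one_mul, zero_mul, sub_zero, zero_sub, neg_eq_zero, Int.cast_eq_zero] at h0 h1
  exact Prod.ext h1 h0

theorem brk_injective : Function.Injective brk := by
  intro a b h
  have h' : brk (a - b) + brk b = brk b := by rw [← brk_add, sub_add_cancel, h]
  exact sub_eq_zero.1 ((brk_eq_zero_iff _).1 (add_eq_right.1 h'))

theorem Tbox_uu_sub_C (a : ℤ × ℤ) :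
    Tbox (uu - RatFunc.C (brk a)) =
      ((uu - RatFunc.C (brk (a + (0, 0)))) * (uu - RatFunc.C (brk (a + (1, 1))))) /
        ((uu - RatFunc.C (brk (a + (1, 0)))) * (uu - RatFunc.C (brk (a + (0, 1))))) := by
  simp only [Tbox, brk_add, map_add, sub_sub]

theorem Tbox_uu_sub_C_ne_zero (a : ℤ × ℤ) : Tbox (uu - RatFunc.C (brk a)) ≠ 0 := by
  rw [Tbox_uu_sub_C]
  exact div_ne_zero (mul_ne_zero (uu_sub_C_ne_zero _) (uu_sub_C_ne_zero _))
    (mul_ne_zero (uu_sub_C_ne_zero _) (uu_sub_C_ne_zero _))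

theorem polOrder_Tbox (a c : ℤ × ℤ) :
    polOrder (Tbox (uu - RatFunc.C (brk a))) (brk c) =
      (if c = a + (1, 0) then 1 else 0) + (if c = a + (0, 1) then 1 else 0)
        - (if c = a + (0, 0) then 1 else 0) - (if c = a + (1, 1) then 1 else 0) := by
  have h := uu_sub_C_ne_zero
  rw [Tbox_uu_sub_C, polOrder_div (mul_ne_zero (h _) (h _)) (mul_ne_zero (h _) (h _)),
    polOrder_mul (h _) (h _), polOrder_mul (h _) (h _)]
  simp only [polOrder_uu_sub_C, brk_injective.eq_iff]
  ring

theorem zb_injective : Function.Injective zb := by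
  rintro ⟨a, b⟩ ⟨c, d⟩ h
  simpa [zb] using h

theorem sum_ite_eq_zb_add (S : Finset Box) (z v : ℤ × ℤ) :
    (∑ b ∈ S, if z = zb b + v then (1 : ℤ) else 0) = if ∃ b ∈ S, zb b + v = z then 1 else 0 := by
  split_ifs with h
  · obtain ⟨b, hb, rfl⟩ := h
    simp only [add_left_inj, zb_injective.eq_iff]
    simp [hb]
  · exact Finset.sum_eq_zero fun b hb => if_neg fun hz => h ⟨b, hb, hz.symm⟩

theorem mem_Outer (S : Finset Box) (t : Box) : t ∈ Outer S ↔ addable S t := by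
  simp only [Outer, Finset.mem_filter, Finset.mem_product, Finset.mem_range, and_iff_right_iff_imp]
  rintro ⟨-, h1, h2⟩
  constructor
  · rcases h1 with h | h
    · omega
    · have := Finset.le_sup (f := Prod.fst) h
      simp only at this
      omega
  · rcases h2 with h | h
    · omega
    · have := Finset.le_sup (f := Prod.snd) h
      simp only at this
      omega

/-- The signed count of the neighbours of `z` in a Young diagram detects the corners at `z`. -/
theorem corner_indicator {S : Finset Box} (hS : IsYoung S) (z : ℤ × ℤ) :
    ((if ∃ b ∈ S, zb b + (1, 0) = z then (1 : ℤ) else 0)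
        + (if ∃ b ∈ S, zb b + (0, 1) = z then 1 else 0)
        - (if ∃ b ∈ S, zb b + (0, 0) = z then 1 else 0)
        - (if ∃ b ∈ S, zb b + (1, 1) = z then 1 else 0)) =
      (if ∃ t ∈ Outer S, zb t = z then 1 else 0)
        - (if (∃ t ∈ Iplus S, zb t = z) ∨ z = (0, 0) then 1 else 0) := by
  have down : ∀ {a b c d : ℕ}, (a, b) ∈ S → c ≤ a → d ≤ b → (c, d) ∈ S :=
    fun h h1 h2 => hS (Prod.mk_le_mk.2 ⟨h1, h2⟩) h
  by_cases hz : 0 ≤ z.1 ∧ 0 ≤ z.2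
  · obtain ⟨x, y⟩ := z
    obtain ⟨hx, hy⟩ := hz
    lift x to ℕ using hx
    lift y to ℕ using hy
    have e1 : (∃ b ∈ S, zb b + (1, 0) = ((x : ℤ), (y : ℤ))) ↔ x ≠ 0 ∧ (x - 1, y) ∈ S := by
      constructor
      · rintro ⟨⟨a, b⟩, hb, h⟩
        simp only [zb, Prod.mk_add_mk, Prod.mk.injEq] at h
        obtain ⟨rfl, rfl⟩ : x = a + 1 ∧ y = b := by omega
        simpa using hb
      · rintro ⟨h, hb⟩
        exact ⟨_, hb, by simp only [zb, Prod.mk_add_mk, Prod.mk.injEq]; omega⟩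
    have e2 : (∃ b ∈ S, zb b + (0, 1) = ((x : ℤ), (y : ℤ))) ↔ y ≠ 0 ∧ (x, y - 1) ∈ S := by
      constructor
      · rintro ⟨⟨a, b⟩, hb, h⟩
        simp only [zb, Prod.mk_add_mk, Prod.mk.injEq] at h
        obtain ⟨rfl, rfl⟩ : x = a ∧ y = b + 1 := by omega
        simpa using hb
      · rintro ⟨h, hb⟩
        exact ⟨_, hb, by simp only [zb, Prod.mk_add_mk, Prod.mk.injEq]; omega⟩
    have e3 : (∃ b ∈ S, zb b + (0, 0) = ((x : ℤ), (y : ℤ))) ↔ (x, y) ∈ S := by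
      simp [zb]
    have e4 : (∃ b ∈ S, zb b + (1, 1) = ((x : ℤ), (y : ℤ))) ↔
        x ≠ 0 ∧ y ≠ 0 ∧ (x - 1, y - 1) ∈ S := by
      constructor
      · rintro ⟨⟨a, b⟩, hb, h⟩
        simp only [zb, Prod.mk_add_mk, Prod.mk.injEq] at h
        obtain ⟨rfl, rfl⟩ : x = a + 1 ∧ y = b + 1 := by omega
        simpa using hb
      · rintro ⟨h, h', hb⟩
        exact ⟨_, hb, by simp only [zb, Prod.mk_add_mk, Prod.mk.injEq]; omega⟩
    have e5 : (∃ t ∈ Outer S, zb t = ((x : ℤ), (y : ℤ))) ↔ addable S (x, y) := by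
      simp [zb, mem_Outer]
    have e6 : (∃ t ∈ Iplus S, zb t = ((x : ℤ), (y : ℤ))) ↔
        x ≠ 0 ∧ y ≠ 0 ∧ (x - 1, y - 1) ∈ S ∧ (x, y - 1) ∉ S ∧ (x - 1, y) ∉ S := by
      constructor
      · rintro ⟨t, ht, h⟩
        simp only [Iplus, Inner, Finset.mem_image, Finset.mem_filter] at ht
        obtain ⟨⟨a, b⟩, hb, rfl⟩ := ht
        simp only [zb, Prod.mk.injEq] at h
        obtain ⟨rfl, rfl⟩ : x = a + 1 ∧ y = b + 1 := by omega
        simpa using hb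
      · rintro ⟨h, h', hb⟩
        obtain ⟨a, rfl⟩ := Nat.exists_eq_succ_of_ne_zero h
        obtain ⟨b, rfl⟩ := Nat.exists_eq_succ_of_ne_zero h'
        refine ⟨(a + 1, b + 1), ?_, rfl⟩
        simp only [Iplus, Inner, Finset.mem_image, Finset.mem_filter]
        exact ⟨(a, b), by simpa using hb, rfl⟩
    have e7 : ((x : ℤ), (y : ℤ)) = (0, 0) ↔ x = 0 ∧ y = 0 := by simp
    simp only [e1, e2, e3, e4, e5, e6, e7, addable]
    have d1 : (x, y) ∈ S → (x - 1, y) ∈ S := fun h => down h (Nat.sub_le _ _) le_rfl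
    have d2 : (x, y) ∈ S → (x, y - 1) ∈ S := fun h => down h le_rfl (Nat.sub_le _ _)
    have d3 : (x - 1, y) ∈ S → (x - 1, y - 1) ∈ S := fun h => down h le_rfl (Nat.sub_le _ _)
    have d4 : (x, y - 1) ∈ S → (x - 1, y - 1) ∈ S := fun h => down h (Nat.sub_le _ _) le_rfl
    clear e1 e2 e3 e4 e5 e6 e7 down hS
    grind
  · have key : ∀ (t : Box) (v : ℤ × ℤ), 0 ≤ v.1 → 0 ≤ v.2 → zb t + v ≠ z := by
      rintro t v h1 h2 rfl
      exact hz ⟨add_nonneg (Int.natCast_nonneg _) h1, add_nonneg (Int.natCast_nonneg _) h2⟩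
    have key0 : ∀ t : Box, zb t ≠ z := fun t => by simpa using key t 0 le_rfl le_rfl
    have hz0 : z ≠ (0, 0) := by
      rintro rfl
      simp at hz
    simp [key, key0, hz0]

theorem polOrder_TM (Γ : Multiset Box) (c : K) :
    polOrder (TM Γ) c =
      (Γ.map fun b => polOrder (Tbox (uu - RatFunc.C (brkN b))) c).sum := by
  rw [TM, TMat, polOrder_multiset_prod, Multiset.map_map]
  · rfl
  · intro f hf
    obtain ⟨b, -, rfl⟩ := Multiset.mem_map.1 hf
    exact Tbox_uu_sub_C_ne_zero _

theorem sum_map_star {A : Type*} [AddCommMonoid A] (μ ν : Finset Box) (f : Box → A) :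
    ((star μ ν).map f).sum = ∑ t ∈ ν, ∑ b ∈ μ, f (b.1 + t.1, b.2 + t.2) := by
  rw [Finset.sum_comm, star, Multiset.map_bind, Multiset.sum_bind]
  simp only [Multiset.map_map]
  rfl

/-- The pole order of `T_{μ*ν}` at `u = [s]`. -/
theorem stmt10 (μ ν : Finset Box) (hμ : IsYoung μ) (hν : IsYoung ν) (s : ℤ × ℤ) :
    polOrder (TM (star μ ν)) (brk s) =
      ((ν.filter fun b => ∃ t ∈ Outer μ, zb t = s - zb b).card : ℤ) -
        ((ν.filter fun b =>
            (∃ t ∈ Iplus μ, zb t = s - zb b) ∨ s - zb b = (0, 0)).card : ℤ) := by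
  rw [polOrder_TM, sum_map_star]
  have hshift : ∀ (b t : Box) (v : ℤ × ℤ),
      s = zb (b.1 + t.1, b.2 + t.2) + v ↔ s - zb t = zb b + v := by
    intro b t v
    simp only [zb, Prod.ext_iff, Prod.fst_add, Prod.snd_add, Prod.fst_sub, Prod.snd_sub]
    push_cast
    omega
  simp only [brkN, polOrder_Tbox, hshift, Finset.sum_sub_distrib, Finset.sum_add_distrib,
    sum_ite_eq_zb_add]
  simp only [← Finset.sum_sub_distrib, ← Finset.sum_add_distrib, corner_indicator hμ]
  simp [Finset.sum_sub_distrib, Finset.sum_boole]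

end JackLR
end

section
/- Let μ be a partition, m,n ≥ 1, σ := μ ∩ m^n, and σ̄ the complement of σ in m^n. Let s ∈ O_μ with s ∉ m^n (s outside the rectangle), and let μ∪s denote μ with the box s added. Then the rational function T_{σ̄}(u) is defined at the point u = [v⁻ − s] ∈ ℚ(α), and T_{σ̄}([v⁻ − s]) = (∏_{b∈R^s_{μ∪m^n}} uh_{μ∪m^n}(b) · ∏_{b∈C^s_{μ∪m^n}} lh_{μ∪m^n}(b) · ∏_{b∈R^s_{μ∪s}} uh_{μ∪s}(b) · ∏_{b∈C^s_{μ∪s}} lh_{μ∪s}(b)) / (∏_{b∈R^s_{(μ∪s)∪m^n}} uh_{(μ∪s)∪m^n}(b) · ∏_{b∈C^s_{(μ∪s)∪m^n}} lh_{(μ∪s)∪m^n}(b) · ∏_{b∈R^s_{μ}} uh_{μ}(b) · ∏_{b∈C^s_{μ}} lh_{μ}(b)). -/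
/-!
Common setup: boxes, Young diagrams as finite lower sets of boxes (French notation),
arms, legs, hooks, the field `ℚ(α)`, rational functions in `u` over `ℚ(α)`,
the functions `T_Γ`, corners, star products, rectangles and complements.
-/

open scoped BigOperators

attribute [local instance] Classical.propDecidable

namespace JackLR

lemma brk_ne_zero {c : ℤ × ℤ} (hc : c.1 ≠ 0 ∨ c.2 ≠ 0) : brk c ≠ 0 := by
  intro h
  have hp : (Polynomial.X * Polynomial.C (c.1 : ℚ) - Polynomial.C (c.2 : ℚ)) = 0 := by
    apply RatFunc.algebraMap_injective ℚ
    simpa [brk, alpha] using h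
  have h₀ : c.2 = 0 := by simpa using congrArg (Polynomial.eval 0) hp
  have h₁ : c.1 = 0 := by simpa [h₀] using congrArg (Polynomial.eval 1) hp
  exact hc.elim (fun h => h h₁) fun h => h h₀

lemma uh_ne_zero (S : Finset Box) (b : Box) : uh S b ≠ 0 :=
  brk_ne_zero (Or.inl (by simp only [hup]; omega))

lemma lh_ne_zero (S : Finset Box) (b : Box) : lh S b ≠ 0 :=
  brk_ne_zero (Or.inr (by simp only [hlo]; omega))

/-- `f` is defined at `c` and takes the value `v` there. -/
def HasValue (f : F) (c v : K) : Prop :=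
  f.denom.eval c ≠ 0 ∧ RatFunc.eval (RingHom.id K) c f = v

lemma HasValue.mul {f g : F} {c v w : K} (hf : HasValue f c v) (hg : HasValue g c w) :
    HasValue (f * g) c (v * w) := by
  refine ⟨?_, ?_⟩
  · intro h
    have hd := Polynomial.eval_dvd (x := c) (RatFunc.denom_mul_dvd f g)
    rw [h, zero_dvd_iff, Polynomial.eval_mul] at hd
    exact mul_ne_zero hf.1 hg.1 hd
  · rw [RatFunc.eval_mul (RingHom.id K) (a := c) hf.1 hg.1, hf.2, hg.2]

lemma HasValue.one (c : K) : HasValue 1 c 1 := by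
  simp [HasValue]

lemma HasValue.prod {ι : Type*} {t : Finset ι} {f : ι → F} {c : K} {v : ι → K}
    (h : ∀ i ∈ t, HasValue (f i) c (v i)) : HasValue (∏ i ∈ t, f i) c (∏ i ∈ t, v i) := by
  induction t using Finset.induction_on with
  | empty => simpa using HasValue.one c
  | insert i t hi ih =>
    rw [Finset.prod_insert hi, Finset.prod_insert hi]
    exact (h i (Finset.mem_insert_self i t)).mul
      (ih fun j hj => h j (Finset.mem_insert_of_mem hj))

lemma hasValue_div (p q : Polynomial K) (c : K) (hq : q.eval c ≠ 0) :
    HasValue (algebraMap (Polynomial K) F p / algebraMap (Polynomial K) F q) c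
      (p.eval c / q.eval c) := by
  have hq0 : q ≠ 0 := by
    rintro rfl
    simp at hq
  have hd : ((algebraMap (Polynomial K) F p / algebraMap (Polynomial K) F q).denom).eval c ≠ 0 := by
    intro h
    have hdvd := Polynomial.eval_dvd (x := c) (RatFunc.denom_div_dvd p q)
    rw [h, zero_dvd_iff] at hdvd
    exact hq hdvd
  refine ⟨hd, ?_⟩
  have hm := RatFunc.eval_mul (RingHom.id K) (a := c)
    (x := algebraMap (Polynomial K) F p / algebraMap (Polynomial K) F q)
    (y := algebraMap (Polynomial K) F q) hd (by simp)
  rw [div_mul_cancel₀ _ (by simpa using hq0)] at hm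
  rw [eq_div_iff hq]
  simpa [Polynomial.eval₂_id] using hm.symm

/-- The value `T_□([c])`. -/
noncomputable def boxValue (c : ℤ × ℤ) : K :=
  (brk c * brk (c.1 - 1, c.2 - 1)) / (brk (c.1 - 1, c.2) * brk (c.1, c.2 - 1))

lemma hasValue_Tbox (a b : ℤ × ℤ) (h₁ : brk (a.1 - b.1 - 1, a.2 - b.2) ≠ 0)
    (h₂ : brk (a.1 - b.1, a.2 - b.2 - 1) ≠ 0) :
    HasValue (Tbox (uu - RatFunc.C (brk b))) (brk a) (boxValue (a.1 - b.1, a.2 - b.2)) := by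
  let l (d : ℤ × ℤ) : Polynomial K := Polynomial.X - Polynomial.C (brk b) - Polynomial.C (brk d)
  have hl (d : ℤ × ℤ) : (l d).eval (brk a) = brk (a.1 - b.1 - d.1, a.2 - b.2 - d.2) := by
    simp only [l, Polynomial.eval_sub, Polynomial.eval_X, Polynomial.eval_C, brk]
    push_cast
    ring
  have key := hasValue_div (l (0, 0) * l (1, 1)) (l (1, 0) * l (0, 1)) (brk a) (by
    rw [Polynomial.eval_mul, hl, hl]
    simpa using ⟨h₁, h₂⟩)
  rw [Polynomial.eval_mul, Polynomial.eval_mul, hl, hl, hl, hl] at key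
  simpa [l, Tbox, uu, boxValue] using key

lemma hasValue_TS_complIn (m n : ℕ) (μ : Finset Box) (s : Box) (hout : s ∉ rect m n) :
    HasValue (TS (complIn m n (μ ∩ rect m n))) (brk (zb (vminus m n) - zb s))
      (∏ b ∈ rect m n \ μ, boxValue (zb b - zb s)) := by
  have hinj : Set.InjOn (conjBox m n) (rect m n \ (μ ∩ rect m n) : Finset Box) := by
    intro b hb b' hb' h
    simp only [Finset.coe_sdiff, Set.mem_sdiff, Finset.mem_coe, rect, Finset.mem_product,
      Finset.mem_range] at hb hb'
    simp only [conjBox, Prod.mk.injEq] at h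
    ext <;> omega
  have hprod : TS (complIn m n (μ ∩ rect m n)) =
      ∏ b ∈ rect m n \ μ, Tbox (uu - RatFunc.C (brkN (conjBox m n b))) := by
    change ∏ b ∈ complIn m n (μ ∩ rect m n), Tbox (uu - RatFunc.C (brkN b)) = _
    rw [complIn, Finset.prod_image hinj, Finset.sdiff_inter_self_right]
  rw [hprod]
  refine HasValue.prod fun b hb => ?_
  simp only [rect, Finset.mem_sdiff, Finset.mem_product, Finset.mem_range, not_and_or,
    not_lt] at hb hout
  have hsub : ((zb (vminus m n) - zb s).1 - (zb (conjBox m n b)).1,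
      (zb (vminus m n) - zb s).2 - (zb (conjBox m n b)).2) = zb b - zb s := by
    ext <;> simp only [zb, vminus, conjBox, Prod.fst_sub, Prod.snd_sub] <;> omega
  have hfst := congrArg Prod.fst hsub
  have hsnd := congrArg Prod.snd hsub
  simp only at hfst hsnd
  rw [← hsub]
  refine hasValue_Tbox _ _ (brk_ne_zero ?_) (brk_ne_zero ?_) <;> rw [hfst, hsnd] <;>
    simp only [zb, Prod.fst_sub, Prod.snd_sub] <;> omega

lemma prod_Ico_telescope (p q : ℕ → K) {h H : ℕ} (hH : h ≤ H) (hp : ∀ i, p i ≠ 0)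
    (hq : ∀ i, q i ≠ 0) :
    ∏ i ∈ Finset.Ico h H, (p (i + 1) * q i) / (q (i + 1) * p i) = (p H * q h) / (q H * p h) := by
  induction H, hH using Nat.le_induction with
  | base =>
    have := hp h
    have := hq h
    simp only [Finset.Ico_self, Finset.prod_empty]
    field_simp
  | succ k hk ih =>
    rw [Finset.prod_Ico_succ_top hk, ih]
    have := hp h
    have := hq h
    have := hp k
    have := hq k
    have := hp (k + 1)
    have := hq (k + 1)
    field_simp

lemma leg_add {S : Finset Box} {x y H : ℕ} (hS : ∀ j, (x, j) ∈ S ↔ j < H) (hy : y < H) :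
    leg S (x, y) + y + 1 = H := by
  have h : (S.filter fun b => b.1 = x ∧ y < b.2) = (Finset.Ioo y H).image fun j => (x, j) := by
    ext ⟨i, j⟩
    simp only [Finset.mem_filter, Finset.mem_image, Finset.mem_Ioo, Prod.mk.injEq]
    constructor
    · rintro ⟨hb, rfl, hj⟩
      exact ⟨j, ⟨hj, (hS j).1 hb⟩, rfl, rfl⟩
    · rintro ⟨j, ⟨hj, hj'⟩, rfl, rfl⟩
      exact ⟨(hS j).2 hj', rfl, hj⟩
  rw [leg, h, Finset.card_image_of_injective _ (Prod.mk_right_injective x), Nat.card_Ioo]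
  omega

lemma arm_add {S : Finset Box} {x y L : ℕ} (hS : ∀ i, (i, y) ∈ S ↔ i < L) (hx : x < L) :
    arm S (x, y) + x + 1 = L := by
  have h : (S.filter fun b => b.2 = y ∧ x < b.1) = (Finset.Ioo x L).image fun i => (i, y) := by
    ext ⟨i, j⟩
    simp only [Finset.mem_filter, Finset.mem_image, Finset.mem_Ioo, Prod.mk.injEq]
    constructor
    · rintro ⟨hb, rfl, hi⟩
      exact ⟨i, ⟨hi, (hS i).1 hb⟩, rfl, rfl⟩
    · rintro ⟨i, ⟨hi, hi'⟩, rfl, rfl⟩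
      exact ⟨(hS i).2 hi', rfl, hi⟩
  rw [arm, h, Finset.card_image_of_injective _ (Prod.mk_left_injective y), Nat.card_Ioo]
  omega

lemma uh_eq_brk {S : Finset Box} {x y L H : ℕ} (hrow : ∀ i, (i, y) ∈ S ↔ i < L)
    (hcol : ∀ j, (x, j) ∈ S ↔ j < H) (hx : x < L) (hy : y < H) :
    uh S (x, y) = brk ((L : ℤ) - x, (y : ℤ) + 1 - H) := by
  have h₁ := arm_add hrow hx
  have h₂ := leg_add hcol hy
  rw [uh, hup]
  congr 2 <;> omega

lemma lh_eq_brk {S : Finset Box} {x y L H : ℕ} (hrow : ∀ i, (i, y) ∈ S ↔ i < L)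
    (hcol : ∀ j, (x, j) ∈ S ↔ j < H) (hx : x < L) (hy : y < H) :
    lh S (x, y) = brk ((L : ℤ) - x - 1, (y : ℤ) - H) := by
  have h₁ := arm_add hrow hx
  have h₂ := leg_add hcol hy
  rw [lh, hlo]
  congr 2 <;> omega

lemma arm_union_rect {m n : ℕ} (S : Finset Box) {b : Box} (hb : b ∉ rect m n) :
    arm (S ∪ rect m n) b = arm S b := by
  rw [arm, arm]
  congr 1
  ext c
  simp only [rect, Finset.mem_filter, Finset.mem_union, Finset.mem_product, Finset.mem_range]
    at hb ⊢
  constructor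
  · rintro ⟨h | h, h'⟩
    · exact ⟨h, h'⟩
    · omega
  · tauto

lemma leg_union_rect {m n : ℕ} (S : Finset Box) {b : Box} (hb : b ∉ rect m n) :
    leg (S ∪ rect m n) b = leg S b := by
  rw [leg, leg]
  congr 1
  ext c
  simp only [rect, Finset.mem_filter, Finset.mem_union, Finset.mem_product, Finset.mem_range]
    at hb ⊢
  constructor
  · rintro ⟨h | h, h'⟩
    · exact ⟨h, h'⟩
    · omega
  · tauto

lemma uh_union_rect {m n : ℕ} (S : Finset Box) {b : Box} (hb : b ∉ rect m n) :
    uh (S ∪ rect m n) b = uh S b := by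
  rw [uh, uh, hup, hup, arm_union_rect S hb, leg_union_rect S hb]

lemma lh_union_rect {m n : ℕ} (S : Finset Box) {b : Box} (hb : b ∉ rect m n) :
    lh (S ∪ rect m n) b = lh S b := by
  rw [lh, lh, hlo, hlo, arm_union_rect S hb, leg_union_rect S hb]

lemma mem_row_iff {μ : Finset Box} (hμ : IsYoung μ) {a c : ℕ} (hs : addable μ (a, c)) (i : ℕ) :
    (i, c) ∈ μ ↔ i < a := by
  obtain ⟨h₀, h₁, -⟩ := hs
  simp only at h₁
  constructor
  · intro hi
    by_contra! hai
    exact h₀ (hμ (show ((a, c) : Box) ≤ (i, c) from ⟨hai, le_rfl⟩) hi)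
  · intro hi
    exact hμ (show ((i, c) : Box) ≤ (a - 1, c) from ⟨by simp only; omega, le_rfl⟩)
      (h₁.resolve_left (by omega))

lemma mem_col_iff {μ : Finset Box} (hμ : IsYoung μ) {a c : ℕ} (hs : addable μ (a, c)) (j : ℕ) :
    (a, j) ∈ μ ↔ j < c := by
  obtain ⟨h₀, -, h₁⟩ := hs
  simp only at h₁
  constructor
  · intro hj
    by_contra! hcj
    exact h₀ (hμ (show ((a, c) : Box) ≤ (a, j) from ⟨le_rfl, hcj⟩) hj)
  · intro hj
    exact hμ (show ((a, j) : Box) ≤ (a, c - 1) from ⟨le_rfl, by simp only; omega⟩)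
      (h₁.resolve_left (by omega))

lemma exists_height {μ : Finset Box} (hμ : IsYoung μ) (x : ℕ) :
    ∃ H, ∀ j, (x, j) ∈ μ ↔ j < H := by
  have hex : ∃ j, (x, j) ∉ μ := by
    obtain ⟨j, hj⟩ := Infinite.exists_notMem_finset (μ.image Prod.snd)
    exact ⟨j, fun h => hj (Finset.mem_image_of_mem Prod.snd h)⟩
  refine ⟨Nat.find hex, fun j => ⟨fun hj => ?_, fun hj => not_not.1 (Nat.find_min hex hj)⟩⟩
  by_contra! h
  exact Nat.find_spec hex (hμ (show ((x, Nat.find hex) : Box) ≤ (x, j) from ⟨le_rfl, h⟩) hj)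

lemma exists_width {μ : Finset Box} (hμ : IsYoung μ) (y : ℕ) :
    ∃ L, ∀ i, (i, y) ∈ μ ↔ i < L := by
  have hex : ∃ i, (i, y) ∉ μ := by
    obtain ⟨i, hi⟩ := Infinite.exists_notMem_finset (μ.image Prod.fst)
    exact ⟨i, fun h => hi (Finset.mem_image_of_mem Prod.fst h)⟩
  refine ⟨Nat.find hex, fun i => ⟨fun hi => ?_, fun hi => not_not.1 (Nat.find_min hex hi)⟩⟩
  by_contra! h
  exact Nat.find_spec hex (hμ (show ((Nat.find hex, y) : Box) ≤ (i, y) from ⟨h, le_rfl⟩) hi)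

/-- The contribution of a box `b` in the row of `s` to the hook product ratio. -/
noncomputable def rowRatio (m n : ℕ) (μ : Finset Box) (s b : Box) : K :=
  (uh (μ ∪ rect m n) b * uh (insert s μ) b) / (uh (insert s μ ∪ rect m n) b * uh μ b)

/-- The contribution of a box `b` in the column of `s` to the hook product ratio. -/
noncomputable def colRatio (m n : ℕ) (μ : Finset Box) (s b : Box) : K :=
  (lh (μ ∪ rect m n) b * lh (insert s μ) b) / (lh (insert s μ ∪ rect m n) b * lh μ b)

lemma rowRatio_eq_one {m n : ℕ} (μ : Finset Box) (s : Box) {b : Box} (hb : b ∉ rect m n) :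
    rowRatio m n μ s b = 1 := by
  rw [rowRatio, uh_union_rect _ hb, uh_union_rect _ hb, mul_comm]
  exact div_self (mul_ne_zero (uh_ne_zero _ _) (uh_ne_zero _ _))

lemma colRatio_eq_one {m n : ℕ} (μ : Finset Box) (s : Box) {b : Box} (hb : b ∉ rect m n) :
    colRatio m n μ s b = 1 := by
  rw [colRatio, lh_union_rect _ hb, lh_union_rect _ hb, mul_comm]
  exact div_self (mul_ne_zero (lh_ne_zero _ _) (lh_ne_zero _ _))

lemma rowOf_eq_image {S : Finset Box} {a c L : ℕ} (hS : ∀ i, (i, c) ∈ S ↔ i < L) :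
    rowOf S (a, c) = (Finset.range L).image fun i => (i, c) := by
  ext ⟨i, j⟩
  simp only [rowOf, Finset.mem_filter, Finset.mem_image, Finset.mem_range, Prod.mk.injEq]
  constructor
  · rintro ⟨hb, rfl⟩
    exact ⟨i, (hS i).1 hb, rfl, rfl⟩
  · rintro ⟨i, hi, rfl, rfl⟩
    exact ⟨(hS i).2 hi, rfl⟩

lemma colOf_eq_image {S : Finset Box} {a c H : ℕ} (hS : ∀ j, (a, j) ∈ S ↔ j < H) :
    colOf S (a, c) = (Finset.range H).image fun j => (a, j) := by
  ext ⟨i, j⟩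
  simp only [colOf, Finset.mem_filter, Finset.mem_image, Finset.mem_range, Prod.mk.injEq]
  constructor
  · rintro ⟨hb, rfl⟩
    exact ⟨j, (hS j).1 hb, rfl, rfl⟩
  · rintro ⟨j, hj, rfl, rfl⟩
    exact ⟨(hS j).2 hj, rfl⟩

lemma prod_rowOf {S : Finset Box} {a c L : ℕ} (hS : ∀ i, (i, c) ∈ S ↔ i < L) (f : Box → K) :
    ∏ b ∈ rowOf S (a, c), f b = ∏ i ∈ Finset.range L, f (i, c) := by
  rw [rowOf_eq_image hS, Finset.prod_image (Prod.mk_left_injective c).injOn]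

lemma prod_colOf {S : Finset Box} {a c H : ℕ} (hS : ∀ j, (a, j) ∈ S ↔ j < H) (f : Box → K) :
    ∏ b ∈ colOf S (a, c), f b = ∏ j ∈ Finset.range H, f (a, j) := by
  rw [colOf_eq_image hS, Finset.prod_image (Prod.mk_right_injective a).injOn]

section AddableOutside

variable {m n a c : ℕ} {μ : Finset Box}

lemma mem_row_insert (hrow : ∀ i, (i, c) ∈ μ ↔ i < a) (i : ℕ) :
    (i, c) ∈ insert (a, c) μ ↔ i < a + 1 := by
  simp only [Finset.mem_insert, Prod.mk.injEq, hrow, and_true]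
  omega

lemma mem_col_insert (hcol : ∀ j, (a, j) ∈ μ ↔ j < c) (j : ℕ) :
    (a, j) ∈ insert (a, c) μ ↔ j < c + 1 := by
  simp only [Finset.mem_insert, Prod.mk.injEq, hcol, true_and]
  omega

lemma mem_row_union_rect {L : ℕ} (hrow : ∀ i, (i, c) ∈ μ ↔ i < L) (h : m ≤ L ∨ n ≤ c) (i : ℕ) :
    (i, c) ∈ μ ∪ rect m n ↔ i < L := by
  simp only [rect, Finset.mem_union, Finset.mem_product, Finset.mem_range, hrow]
  omega

lemma mem_col_union_rect {H : ℕ} (hcol : ∀ j, (a, j) ∈ μ ↔ j < H) (h : m ≤ a ∨ n ≤ H) (j : ℕ) :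
    (a, j) ∈ μ ∪ rect m n ↔ j < H := by
  simp only [rect, Finset.mem_union, Finset.mem_product, Finset.mem_range, hcol]
  omega

lemma hook_ratio_eq (hμ : IsYoung μ) (hs : addable μ (a, c)) (hout : m ≤ a ∨ n ≤ c) :
    ((∏ b ∈ rowOf (μ ∪ rect m n) (a, c), uh (μ ∪ rect m n) b) *
          (∏ b ∈ colOf (μ ∪ rect m n) (a, c), lh (μ ∪ rect m n) b) *
          (∏ b ∈ rowOf (insert (a, c) μ) (a, c), uh (insert (a, c) μ) b) *
          (∏ b ∈ colOf (insert (a, c) μ) (a, c), lh (insert (a, c) μ) b)) /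
        ((∏ b ∈ rowOf (insert (a, c) μ ∪ rect m n) (a, c), uh (insert (a, c) μ ∪ rect m n) b) *
          (∏ b ∈ colOf (insert (a, c) μ ∪ rect m n) (a, c), lh (insert (a, c) μ ∪ rect m n) b) *
          (∏ b ∈ rowOf μ (a, c), uh μ b) * (∏ b ∈ colOf μ (a, c), lh μ b)) =
      (∏ i ∈ Finset.range a, rowRatio m n μ (a, c) (i, c)) *
        ∏ j ∈ Finset.range c, colRatio m n μ (a, c) (a, j) := by
  have hrow := mem_row_iff hμ hs
  have hcol := mem_col_iff hμ hs
  have hmem : (a, c) ∉ rect m n := by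
    simp only [rect, Finset.mem_product, Finset.mem_range]
    omega
  rw [prod_rowOf hrow, prod_colOf hcol, prod_rowOf (mem_row_insert hrow),
    prod_colOf (mem_col_insert hcol), prod_rowOf (mem_row_union_rect hrow hout),
    prod_colOf (mem_col_union_rect hcol hout),
    prod_rowOf (mem_row_union_rect (mem_row_insert hrow) (by omega)),
    prod_colOf (mem_col_union_rect (mem_col_insert hcol) (by omega))]
  simp only [Finset.prod_range_succ, uh_union_rect _ hmem, lh_union_rect _ hmem, rowRatio,
    colRatio, Finset.prod_div_distrib, Finset.prod_mul_distrib]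
  have h₁ := uh_ne_zero (insert (a, c) μ) (a, c)
  have h₂ := lh_ne_zero (insert (a, c) μ) (a, c)
  have hu (S : Finset Box) : ∏ i ∈ Finset.range a, uh S (i, c) ≠ 0 :=
    Finset.prod_ne_zero_iff.2 fun _ _ => uh_ne_zero _ _
  have hl (S : Finset Box) : ∏ j ∈ Finset.range c, lh S (a, j) ≠ 0 :=
    Finset.prod_ne_zero_iff.2 fun _ _ => lh_ne_zero _ _
  have h₃ := hu μ
  have h₄ := hl μ
  have h₅ := hu (insert (a, c) μ ∪ rect m n)
  have h₆ := hl (insert (a, c) μ ∪ rect m n)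
  field_simp

lemma boxValue_eq_neg (x y : ℤ) :
    boxValue (x, y) = (brk (-x, -y) * brk (1 - x, 1 - y)) / (brk (1 - x, -y) * brk (-x, 1 - y)) := by
  rw [boxValue]
  congr 1 <;>
  · simp only [brk]
    push_cast
    ring

lemma prod_column_boxValue (hμ : IsYoung μ) (hs : addable μ (a, c)) (ha : m ≤ a) {x : ℕ}
    (hx : x < m) :
    ∏ y ∈ Finset.range n with (x, y) ∉ μ, boxValue (zb (x, y) - zb (a, c)) =
      rowRatio m n μ (a, c) (x, c) := by
  have hrow := mem_row_iff hμ hs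
  obtain ⟨h, hh⟩ := exists_height hμ x
  have hch : c < h := (hh c).1 ((hrow x).2 (by omega))
  have hset : {y ∈ Finset.range n | (x, y) ∉ μ} = Finset.Ico h (max h n) := by
    ext y
    simp only [Finset.mem_filter, Finset.mem_range, Finset.mem_Ico, hh]
    omega
  have hins (j : ℕ) : (x, j) ∈ insert (a, c) μ ↔ j < h := by
    simp only [Finset.mem_insert, Prod.mk.injEq, hh]
    omega
  have huni {S : Finset Box} (hS : ∀ j, (x, j) ∈ S ↔ j < h) (j : ℕ) :
      (x, j) ∈ S ∪ rect m n ↔ j < max h n := by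
    simp only [rect, Finset.mem_union, Finset.mem_product, Finset.mem_range, hS]
    omega
  have hrow' := mem_row_insert hrow
  have hH : c < max h n := lt_max_of_lt_left hch
  rw [hset, rowRatio, uh_eq_brk hrow hh (by omega) hch, uh_eq_brk hrow' hins (by omega) hch,
    uh_eq_brk (mem_row_union_rect hrow (Or.inl ha)) (huni hh) (by omega) hH,
    uh_eq_brk (mem_row_union_rect hrow' (Or.inl (by omega))) (huni hins) (by omega) hH]
  have key := prod_Ico_telescope (fun y => brk ((a : ℤ) - x, (c : ℤ) + 1 - y))
    (fun y => brk (((a + 1 : ℕ) : ℤ) - x, (c : ℤ) + 1 - y)) (le_max_left h n)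
    (fun i => brk_ne_zero (Or.inl (by simp only; omega)))
    (fun i => brk_ne_zero (Or.inl (by simp only; omega)))
  rw [← key]
  refine Finset.prod_congr rfl fun y _ => ?_
  rw [show zb (x, y) - zb (a, c) = ((x : ℤ) - a, (y : ℤ) - c) from rfl, boxValue_eq_neg]
  simp only [brk]
  push_cast
  congr 1 <;> ring

lemma prod_row_boxValue (hμ : IsYoung μ) (hs : addable μ (a, c)) (hc : n ≤ c) {y : ℕ}
    (hy : y < n) :
    ∏ x ∈ Finset.range m with (x, y) ∉ μ, boxValue (zb (x, y) - zb (a, c)) =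
      colRatio m n μ (a, c) (a, y) := by
  have hcol := mem_col_iff hμ hs
  obtain ⟨l, hl⟩ := exists_width hμ y
  have hal : a < l := (hl a).1 ((hcol y).2 (by omega))
  have hset : {x ∈ Finset.range m | (x, y) ∉ μ} = Finset.Ico l (max l m) := by
    ext x
    simp only [Finset.mem_filter, Finset.mem_range, Finset.mem_Ico, hl]
    omega
  have hins (i : ℕ) : (i, y) ∈ insert (a, c) μ ↔ i < l := by
    simp only [Finset.mem_insert, Prod.mk.injEq, hl]
    omega
  have huni {S : Finset Box} (hS : ∀ i, (i, y) ∈ S ↔ i < l) (i : ℕ) :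
      (i, y) ∈ S ∪ rect m n ↔ i < max l m := by
    simp only [rect, Finset.mem_union, Finset.mem_product, Finset.mem_range, hS]
    omega
  have hcol' := mem_col_insert hcol
  have hL : a < max l m := lt_max_of_lt_left hal
  rw [hset, colRatio, lh_eq_brk hl hcol hal (by omega), lh_eq_brk hins hcol' hal (by omega),
    lh_eq_brk (huni hl) (mem_col_union_rect hcol (Or.inr hc)) hL (by omega),
    lh_eq_brk (huni hins) (mem_col_union_rect hcol' (Or.inr (by omega))) hL (by omega)]
  have key := prod_Ico_telescope (fun x => brk ((x : ℤ) - a - 1, (y : ℤ) - c))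
    (fun x => brk ((x : ℤ) - a - 1, (y : ℤ) - (c + 1 : ℕ))) (le_max_left l m)
    (fun i => brk_ne_zero (Or.inr (by simp only; omega)))
    (fun i => brk_ne_zero (Or.inr (by simp only; omega)))
  rw [← key]
  refine Finset.prod_congr rfl fun x _ => ?_
  rw [show zb (x, y) - zb (a, c) = ((x : ℤ) - a, (y : ℤ) - c) from rfl, boxValue]
  simp only [brk]
  push_cast
  congr 1 <;> ring

lemma prod_boxValue_eq (hμ : IsYoung μ) (hs : addable μ (a, c)) (hout : m ≤ a ∨ n ≤ c) :
    ∏ b ∈ rect m n \ μ, boxValue (zb b - zb (a, c)) =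
      (∏ i ∈ Finset.range a, rowRatio m n μ (a, c) (i, c)) *
        ∏ j ∈ Finset.range c, colRatio m n μ (a, c) (a, j) := by
  rw [Finset.sdiff_eq_filter, Finset.prod_filter, rect]
  rcases hout with h | h
  · rw [Finset.prod_product, Finset.prod_eq_one fun j _ => colRatio_eq_one (b := (a, j)) μ (a, c)
        (by simp only [rect, Finset.mem_product, Finset.mem_range]; omega), mul_one,
      ← Finset.prod_subset (Finset.range_subset_range.2 h) fun i _ hi =>
        rowRatio_eq_one (b := (i, c)) μ (a, c) (by
          simp only [rect, Finset.mem_product, Finset.mem_range] at hi ⊢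
          omega)]
    refine Finset.prod_congr rfl fun x hx => ?_
    rw [← prod_column_boxValue hμ hs h (Finset.mem_range.1 hx), Finset.prod_filter]
  · rw [Finset.prod_product_right, Finset.prod_eq_one (s := Finset.range a) fun i _ =>
        rowRatio_eq_one (b := (i, c)) μ (a, c)
        (by simp only [rect, Finset.mem_product, Finset.mem_range]; omega), one_mul,
      ← Finset.prod_subset (Finset.range_subset_range.2 h) fun j _ hj =>
        colRatio_eq_one (b := (a, j)) μ (a, c) (by
          simp only [rect, Finset.mem_product, Finset.mem_range] at hj ⊢
          omega)]
    refine Finset.prod_congr rfl fun y hy => ?_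
    rw [← prod_row_boxValue hμ hs h (Finset.mem_range.1 hy), Finset.prod_filter]

end AddableOutside

/-- Evaluation of `T_{σ̄}` at `[v⁻ − s]` for an outer corner `s` of `μ`
lying outside the rectangle `m^n`, as a ratio of row/column hook products. -/
theorem stmt15 (m n : ℕ) (hm : 1 ≤ m) (hn : 1 ≤ n) (μ : Finset Box) (hμ : IsYoung μ)
    (s : Box) (hs : addable μ s) (hout : s ∉ rect m n) :
    ((TS (complIn m n (μ ∩ rect m n))).denom.eval (brk (zb (vminus m n) - zb s)) ≠ 0) ∧
    RatFunc.eval (RingHom.id K) (brk (zb (vminus m n) - zb s))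
        (TS (complIn m n (μ ∩ rect m n))) =
      ((∏ b ∈ rowOf (μ ∪ rect m n) s, uh (μ ∪ rect m n) b) *
          (∏ b ∈ colOf (μ ∪ rect m n) s, lh (μ ∪ rect m n) b) *
          (∏ b ∈ rowOf (insert s μ) s, uh (insert s μ) b) *
          (∏ b ∈ colOf (insert s μ) s, lh (insert s μ) b)) /
        ((∏ b ∈ rowOf (insert s μ ∪ rect m n) s, uh (insert s μ ∪ rect m n) b) *
          (∏ b ∈ colOf (insert s μ ∪ rect m n) s, lh (insert s μ ∪ rect m n) b) *
          (∏ b ∈ rowOf μ s, uh μ b) * (∏ b ∈ colOf μ s, lh μ b)) := by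
  obtain ⟨a, c⟩ := s
  have hac : m ≤ a ∨ n ≤ c := by
    simp only [rect, Finset.mem_product, Finset.mem_range] at hout
    omega
  rw [hook_ratio_eq hμ hs hac, ← prod_boxValue_eq hμ hs hac]
  exact hasValue_TS_complIn m n μ (a, c) hout

end JackLR
end
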